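/- arXiv:1210.7324 — 2 statements merged into one kernel-verified Lean document; each statement's English description precedes it below -/
import Mathlib

section
/- Let K be a compact Hausdorff space and let X be a C-rich closed subspace of the real space C(K). Then X (with the induced norm) has the Mazur–Ulam property: for every real Banach space F, every surjective isometry T : S_X → S_F is the restriction to S_X of a surjective linear isometry from X onto F. -/
open Metric Set

/-- The slice of the closed unit ball determined by a norm-one functional `f` and `ε`:
`S(f, ε) = {x ∈ B_E : f x > 1 - ε}`. -/
def glSlice {E : Type*} [NormedAddCommGroup E] [NormedSpace ℝ E]
    (f : E →L[ℝ] ℝ) (ε : ℝ) : Set E :=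
  {x | ‖x‖ ≤ 1 ∧ 1 - ε < f x}

/-- A (real) Banach space is a generalized-lush space (GL-space) if for every `x` in the
unit sphere and every `ε > 0` there is a norm-one functional `f` with `x ∈ S(f, ε)` and
`dist(y, S(f, ε)) + dist(y, -S(f, ε)) < 2 + ε` for every `y` in the unit sphere. -/
def IsGLSpace (E : Type*) [NormedAddCommGroup E] [NormedSpace ℝ E] : Prop :=
  ∀ x : E, ‖x‖ = 1 → ∀ ε : ℝ, 0 < ε →
    ∃ f : E →L[ℝ] ℝ, ‖f‖ = 1 ∧ x ∈ glSlice f ε ∧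
      ∀ y : E, ‖y‖ = 1 →
        infDist y (glSlice f ε) + infDist y (-(glSlice f ε)) < 2 + ε

open ContinuousMap in
/-- `X` is a C-rich closed subspace of `C(K)`: for every nonempty open `U ⊆ K` and `ε > 0`
there is a nonnegative norm-one `h ∈ C(K)` supported in `U` with `dist(h, X) < ε`. -/
def IsCRich {K : Type*} [TopologicalSpace K] [CompactSpace K]
    (X : Subspace ℝ C(K, ℝ)) : Prop :=
  IsClosed (X : Set C(K, ℝ)) ∧
    ∀ U : Set K, IsOpen U → U.Nonempty → ∀ ε : ℝ, 0 < ε →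
      ∃ h : C(K, ℝ), (∀ t, 0 ≤ h t) ∧ ‖h‖ = 1 ∧ tsupport ⇑h ⊆ U ∧
        infDist h (X : Set C(K, ℝ)) < ε

open Filter Topology

/-- `T` restricts to a surjective isometry between the unit spheres of `E` and `F`. -/
structure IsSphereIsometry {E F : Type*} [NormedAddCommGroup E] [NormedSpace ℝ E]
    [NormedAddCommGroup F] [NormedSpace ℝ F] (T : E → F) : Prop where
  norm_map : ∀ x : E, ‖x‖ = 1 → ‖T x‖ = 1
  surj : ∀ z : F, ‖z‖ = 1 → ∃ x : E, ‖x‖ = 1 ∧ T x = z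
  isometry : ∀ x y : E, ‖x‖ = 1 → ‖y‖ = 1 → ‖T x - T y‖ = ‖x - y‖

/-- Every sequence of functionals in the dual unit ball that asymptotically norms `u`
asymptotically norms `v`. -/
def Dominates {E : Type*} [NormedAddCommGroup E] [NormedSpace ℝ E] (u v : ℕ → E) : Prop :=
  ∀ φ : ℕ → StrongDual ℝ E, (∀ n, ‖φ n‖ ≤ 1) →
    Tendsto (fun n => φ n (u n)) atTop (𝓝 1) → Tendsto (fun n => φ n (v n)) atTop (𝓝 1)

section Sequences

variable {E : Type*} [NormedAddCommGroup E] [NormedSpace ℝ E]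

theorem norm_inv_norm_smul {x : E} (hx : x ≠ 0) : ‖‖x‖⁻¹ • x‖ = 1 := by
  rw [norm_smul, norm_inv, norm_norm, inv_mul_cancel₀ (norm_ne_zero_iff.mpr hx)]

theorem norm_inv_norm_smul_sub {x : E} (hx : x ≠ 0) : ‖‖x‖⁻¹ • x - x‖ = |1 - ‖x‖| := by
  have : ‖x‖⁻¹ • x - x = (1 - ‖x‖) • (‖x‖⁻¹ • x) := by
    rw [sub_smul, one_smul, smul_smul, mul_inv_cancel₀ (norm_ne_zero_iff.mpr hx), one_smul]
  rw [this, norm_smul, norm_inv_norm_smul hx, mul_one, Real.norm_eq_abs]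

theorem dual_apply_le_of_norm_le {φ : StrongDual ℝ E} (hφ : ‖φ‖ ≤ 1) {x : E} {c : ℝ} (hx : ‖x‖ ≤ c) :
    φ x ≤ c :=
  calc φ x ≤ ‖φ x‖ := Real.le_norm_self _
    _ ≤ 1 * ‖x‖ := φ.le_of_opNorm_le hφ x
    _ ≤ c := by linarith

theorem tendsto_one_of_add_tendsto_two {a b : ℕ → ℝ} (ha : ∀ n, a n ≤ 1) (hb : ∀ n, b n ≤ 1)
    (h : Tendsto (fun n => a n + b n) atTop (𝓝 2)) :
    Tendsto a atTop (𝓝 1) ∧ Tendsto b atTop (𝓝 1) := by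
  have h' : Tendsto (fun n => a n + b n - 1) atTop (𝓝 1) := by
    convert h.sub_const 1 using 2
    norm_num
  exact ⟨tendsto_of_tendsto_of_tendsto_of_le_of_le h' tendsto_const_nhds
      (fun n => by linarith [hb n]) ha,
    tendsto_of_tendsto_of_tendsto_of_le_of_le h' tendsto_const_nhds
      (fun n => by linarith [ha n]) hb⟩

theorem tendsto_norm_add {a b : ℕ → E} (ha : ∀ n, ‖a n‖ = 1) (hb : ∀ n, ‖b n‖ = 1)
    {φ : ℕ → StrongDual ℝ E} (hφ : ∀ n, ‖φ n‖ ≤ 1)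
    (h₁ : Tendsto (fun n => φ n (a n)) atTop (𝓝 1))
    (h₂ : Tendsto (fun n => φ n (b n)) atTop (𝓝 1)) :
    Tendsto (fun n => ‖a n + b n‖) atTop (𝓝 2) := by
  have h : Tendsto (fun n => φ n (a n) + φ n (b n)) atTop (𝓝 2) := by
    convert h₁.add h₂ using 2
    norm_num
  refine tendsto_of_tendsto_of_tendsto_of_le_of_le h tendsto_const_nhds (fun n => ?_) fun n => ?_
  · simpa using dual_apply_le_of_norm_le (hφ n) (le_refl ‖a n + b n‖)
  · have := norm_add_le (a n) (b n)
    simp only [ha, hb] at this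
    linarith

theorem exists_dual_of_tendsto_norm_add {a b : ℕ → E} (ha : ∀ n, ‖a n‖ = 1)
    (hb : ∀ n, ‖b n‖ = 1) (h : Tendsto (fun n => ‖a n + b n‖) atTop (𝓝 2)) :
    ∃ φ : ℕ → StrongDual ℝ E, (∀ n, ‖φ n‖ ≤ 1) ∧
      Tendsto (fun n => φ n (a n)) atTop (𝓝 1) ∧ Tendsto (fun n => φ n (b n)) atTop (𝓝 1) := by
  choose φ hφ hφ' using fun n => exists_dual_vector'' ℝ (a n + b n)
  refine ⟨φ, hφ, tendsto_one_of_add_tendsto_two (fun n => dual_apply_le_of_norm_le (hφ n) (ha n).le)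
    (fun n => dual_apply_le_of_norm_le (hφ n) (hb n).le) ?_⟩
  simpa [← map_add, hφ'] using h

theorem Dominates.tendsto_norm_add {u v : ℕ → E} (huv : Dominates u v) (hu : ∀ n, ‖u n‖ = 1)
    (hv : ∀ n, ‖v n‖ = 1) : Tendsto (fun n => ‖u n + v n‖) atTop (𝓝 2) := by
  choose φ hφ hφ' using fun n => exists_dual_vector'' ℝ (u n)
  have h : Tendsto (fun n => φ n (u n)) atTop (𝓝 1) := by simp [hφ', hu]
  exact _root_.tendsto_norm_add hu hv hφ h (huv φ hφ h)

theorem Dominates.trans {u v w : ℕ → E} (h₁ : Dominates u v) (h₂ : Dominates v w) :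
    Dominates u w :=
  fun φ hφ h => h₂ φ hφ (h₁ φ hφ h)

/-- The normalized midpoint of two asymptotically aligned sequences of unit vectors. -/
theorem exists_dominates_pair {a b : ℕ → E} (ha : ∀ n, ‖a n‖ = 1) (hb : ∀ n, ‖b n‖ = 1)
    (h : Tendsto (fun n => ‖a n + b n‖) atTop (𝓝 2)) :
    ∃ u : ℕ → E, (∀ n, ‖u n‖ = 1) ∧ Dominates u a ∧ Dominates u b ∧
      ∀ φ : ℕ → StrongDual ℝ E, Tendsto (fun n => φ n (a n)) atTop (𝓝 1) →
        Tendsto (fun n => φ n (b n)) atTop (𝓝 1) →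
        Tendsto (fun n => φ n (u n)) atTop (𝓝 1) := by
  have hex : ∀ n, ∃ u : E, ‖u‖ = 1 ∧ ‖a n + b n‖ • u = a n + b n := by
    intro n
    by_cases h0 : a n + b n = 0
    · exact ⟨a n, ha n, by simp [h0]⟩
    · have h0' : ‖a n + b n‖ ≠ 0 := norm_ne_zero_iff.mpr h0
      exact ⟨‖a n + b n‖⁻¹ • (a n + b n), norm_inv_norm_smul h0, by simp [smul_smul, h0']⟩
  choose u hu hu' using hex
  have key : ∀ (φ : ℕ → StrongDual ℝ E) n, ‖a n + b n‖ * φ n (u n) = φ n (a n) + φ n (b n) := by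
    intro φ n
    rw [← map_add, ← hu' n, map_smul, hu' n, smul_eq_mul]
  have hdom : ∀ φ : ℕ → StrongDual ℝ E, (∀ n, ‖φ n‖ ≤ 1) →
      Tendsto (fun n => φ n (u n)) atTop (𝓝 1) →
      Tendsto (fun n => φ n (a n)) atTop (𝓝 1) ∧ Tendsto (fun n => φ n (b n)) atTop (𝓝 1) := by
    intro φ hφ hφu
    refine tendsto_one_of_add_tendsto_two (fun n => dual_apply_le_of_norm_le (hφ n) (ha n).le)
      (fun n => dual_apply_le_of_norm_le (hφ n) (hb n).le) ?_
    simpa [key] using h.mul hφu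
  refine ⟨u, hu, fun φ hφ hφu => (hdom φ hφ hφu).1, fun φ hφ hφu => (hdom φ hφ hφu).2, ?_⟩
  intro φ h₁ h₂
  have hq : Tendsto (fun n => (φ n (a n) + φ n (b n)) / ‖a n + b n‖) atTop (𝓝 1) := by
    have h' := (h₁.add h₂).div h two_ne_zero
    rwa [show ((1 : ℝ) + 1) / 2 = 1 by norm_num] at h'
  refine hq.congr' ?_
  filter_upwards [h.eventually_ne two_ne_zero] with n hn
  rw [← key, mul_div_cancel_left₀ _ hn]

/-- Finitely many asymptotically aligned sequences of unit vectors are dominated by one. -/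
theorem exists_dominates_of_aligned {κ : Type*} [Fintype κ] [Nonempty κ] {A : κ → ℕ → E}
    (hA : ∀ j n, ‖A j n‖ = 1) {φ : ℕ → StrongDual ℝ E} (hφ : ∀ n, ‖φ n‖ ≤ 1)
    (h : ∀ j, Tendsto (fun n => φ n (A j n)) atTop (𝓝 1)) :
    ∃ u : ℕ → E, (∀ n, ‖u n‖ = 1) ∧ ∀ j, Dominates u (A j) := by
  classical
  suffices H : ∀ S : Finset κ, ∃ u : ℕ → E, (∀ n, ‖u n‖ = 1) ∧
      Tendsto (fun n => φ n (u n)) atTop (𝓝 1) ∧ ∀ j ∈ S, Dominates u (A j) by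
    obtain ⟨u, hu, -, hd⟩ := H Finset.univ
    exact ⟨u, hu, fun j => hd j (Finset.mem_univ j)⟩
  intro S
  induction S using Finset.induction_on with
  | empty =>
    obtain ⟨j⟩ := ‹Nonempty κ›
    exact ⟨A j, hA j, h j, by simp⟩
  | insert j S _ ih =>
    obtain ⟨u, hu, hφu, hd⟩ := ih
    obtain ⟨w, hw, hwu, hwA, hwφ⟩ :=
      exists_dominates_pair hu (hA j) (tendsto_norm_add hu (hA j) hφ hφu (h j))
    refine ⟨w, hw, hwφ φ hφu (h j), fun i hi => ?_⟩
    rcases Finset.mem_insert.mp hi with rfl | hi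
    · exact hwA
    · exact hwu.trans (hd i hi)

theorem exists_dominates_of_tendsto_norm_add {κ : Type*} [Fintype κ] {p : ℕ → E}
    (hp : ∀ n, ‖p n‖ = 1) {v : κ → ℕ → E} (hv : ∀ j n, ‖v j n‖ = 1)
    (h : ∀ u : ℕ → E, (∀ n, ‖u n‖ = 1) → Dominates u p →
      ∀ j, Tendsto (fun n => ‖u n + v j n‖) atTop (𝓝 2)) :
    ∃ u : ℕ → E, (∀ n, ‖u n‖ = 1) ∧ ∀ j, Dominates u (v j) := by
  classical
  suffices H : ∀ S : Finset κ, ∃ u : ℕ → E, (∀ n, ‖u n‖ = 1) ∧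
      Dominates u p ∧ ∀ j ∈ S, Dominates u (v j) by
    obtain ⟨u, hu, -, hd⟩ := H Finset.univ
    exact ⟨u, hu, fun j => hd j (Finset.mem_univ j)⟩
  intro S
  induction S using Finset.induction_on with
  | empty => exact ⟨p, hp, fun _ _ h => h, by simp⟩
  | insert j S _ ih =>
    obtain ⟨u, hu, hup, hd⟩ := ih
    obtain ⟨w, hw, hwu, hwv, -⟩ := exists_dominates_pair hu (hv j) (h u hu hup j)
    refine ⟨w, hw, hwu.trans hup, fun i hi => ?_⟩
    rcases Finset.mem_insert.mp hi with rfl | hi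
    · exact hwv
    · exact hwu.trans (hd i hi)

end Sequences

namespace IsSphereIsometry

variable {E F : Type*} [NormedAddCommGroup E] [NormedSpace ℝ E]
  [NormedAddCommGroup F] [NormedSpace ℝ F] {T : E → F}

theorem exists_inverse (hT : IsSphereIsometry T) :
    ∃ S : F → E, IsSphereIsometry S ∧ ∀ x : E, ‖x‖ = 1 → S (T x) = x := by
  classical
  have hex : ∀ z : F, ∃ x : E, ‖z‖ = 1 → ‖x‖ = 1 ∧ T x = z := by
    intro z
    by_cases hz : ‖z‖ = 1
    · obtain ⟨x, hx⟩ := hT.surj z hz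
      exact ⟨x, fun _ => hx⟩
    · exact ⟨0, fun h => absurd h hz⟩
  choose S hS using hex
  have hinv : ∀ x : E, ‖x‖ = 1 → S (T x) = x := by
    intro x hx
    obtain ⟨h₁, h₂⟩ := hS (T x) (hT.norm_map x hx)
    have := hT.isometry _ _ h₁ hx
    rw [h₂, sub_self, norm_zero] at this
    exact sub_eq_zero.mp (norm_eq_zero.mp this.symm)
  refine ⟨S, ⟨fun z hz => (hS z hz).1, fun x hx => ⟨T x, hT.norm_map x hx, hinv x hx⟩, ?_⟩, hinv⟩
  intro z w hz hw
  rw [← hT.isometry _ _ (hS z hz).1 (hS w hw).1, (hS z hz).2, (hS w hw).2]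

theorem norm_add_gt (hT : IsSphereIsometry T) {r : ℝ} (hr : 0 < r) (hr1 : r < 1) {x y : E}
    (hx : ‖x‖ = 1) (hy : ‖y‖ = 1) (hxy : 2 - r ^ 2 < ‖x + y‖) : 2 - 4 * r < ‖T x + T y‖ := by
  have hr2 : r ^ 2 < r := by nlinarith
  set z₀ : E := r • x + (1 - r) • y with hz₀
  have hz₀le : ‖z₀‖ ≤ 1 := by
    calc ‖z₀‖ ≤ ‖r • x‖ + ‖(1 - r) • y‖ := norm_add_le _ _
      _ = 1 := by
        rw [norm_smul, norm_smul, hx, hy, Real.norm_of_nonneg hr.le,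
          Real.norm_of_nonneg (by linarith)]
        ring
  obtain ⟨f, hf, hfxy⟩ := exists_dual_vector'' ℝ (x + y)
  have hfx := dual_apply_le_of_norm_le hf hx.le
  have hfy := dual_apply_le_of_norm_le hf hy.le
  have hz₀ge : 1 - r ^ 2 < ‖z₀‖ := by
    have h₁ := dual_apply_le_of_norm_le hf (le_refl ‖z₀‖)
    simp only [hz₀, map_add, map_smul, smul_eq_mul, RCLike.ofReal_real_eq_id, id_eq] at h₁ hfxy
    rw [← hz₀] at h₁
    nlinarith
  have hz₀pos : 0 < ‖z₀‖ := by linarith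
  set z : E := ‖z₀‖⁻¹ • z₀ with hz
  have hz1 : ‖z‖ = 1 := by simp [hz, norm_smul, hz₀pos.ne']
  have hzz : ‖z₀‖ • z = z₀ := by simp [hz, smul_smul, hz₀pos.ne']
  have hzy : ‖z - y‖ < 3 * r := by
    have h₁ : ‖z - z₀‖ < r ^ 2 := by
      have : z - z₀ = (1 - ‖z₀‖) • z := by rw [sub_smul, one_smul, hzz]
      rw [this, norm_smul, hz1, Real.norm_of_nonneg (by linarith)]
      linarith
    have h₂ : ‖z₀ - y‖ ≤ 2 * r := by
      have : z₀ - y = r • (x - y) := by rw [hz₀]; module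
      rw [this, norm_smul, Real.norm_of_nonneg hr.le]
      have := norm_sub_le x y
      rw [hx, hy] at this
      nlinarith
    have h₃ := norm_sub_le_norm_sub_add_norm_sub z z₀ y
    linarith
  obtain ⟨w, hw, hTw⟩ := hT.surj (-T z) (by rw [norm_neg, hT.norm_map z hz1])
  have hzw : ‖z - w‖ = 2 := by
    rw [← hT.isometry z w hz1 hw, hTw, sub_neg_eq_add, ← two_smul ℝ, norm_smul,
      hT.norm_map z hz1]
    norm_num
  obtain ⟨g, hg, hgzw⟩ := exists_dual_vector'' ℝ (z - w)
  have hgz := dual_apply_le_of_norm_le hg hz1.le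
  have hgw : g (-w) ≤ 1 := dual_apply_le_of_norm_le hg (by rw [norm_neg, hw])
  have hgy := dual_apply_le_of_norm_le hg hy.le
  have hgxw := dual_apply_le_of_norm_le hg (le_refl ‖x - w‖)
  have hgz₀ : g z₀ = ‖z₀‖ * g z := by rw [← smul_eq_mul, ← map_smul, hzz]
  simp only [hzw, map_sub, map_neg, RCLike.ofReal_real_eq_id, id_eq] at hgzw hgw hgxw
  have hgz1 : g z = 1 := by linarith
  have hgx : 1 - r < g x := by
    rw [hgz1, mul_one, hz₀, map_add, map_smul, map_smul, ← hz₀, smul_eq_mul, smul_eq_mul] at hgz₀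
    have : r * (1 - r) < r * g x := by nlinarith
    exact lt_of_mul_lt_mul_left this hr.le
  have hxw : 2 - r < ‖x - w‖ := by linarith
  have h₁ : ‖T x + T z‖ = ‖x - w‖ := by
    rw [← hT.isometry x w hx hw, hTw, sub_neg_eq_add]
  have h₂ := hT.isometry z y hz1 hy
  have h₃ : ‖T x + T z‖ ≤ ‖T x + T y‖ + ‖T z - T y‖ := by
    have : T x + T z = (T x + T y) + (T z - T y) := by abel
    rw [this]
    exact norm_add_le _ _
  linarith

theorem tendsto_norm_add (hT : IsSphereIsometry T) {a b : ℕ → E} (ha : ∀ n, ‖a n‖ = 1)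
    (hb : ∀ n, ‖b n‖ = 1) (h : Tendsto (fun n => ‖a n + b n‖) atTop (𝓝 2)) :
    Tendsto (fun n => ‖T (a n) + T (b n)‖) atTop (𝓝 2) := by
  have hle : ∀ n, ‖T (a n) + T (b n)‖ ≤ 2 := by
    intro n
    have := norm_add_le (T (a n)) (T (b n))
    rw [hT.norm_map _ (ha n), hT.norm_map _ (hb n)] at this
    linarith
  refine tendsto_order.mpr ⟨fun c hc => ?_, fun c hc => .of_forall fun n => (hle n).trans_lt hc⟩
  set r : ℝ := min ((2 - c) / 4) (1 / 2)
  have hr : 0 < r := lt_min (by linarith) (by norm_num)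
  have hr1 : r < 1 := (min_le_right _ _).trans_lt (by norm_num)
  have hrc : r ≤ (2 - c) / 4 := min_le_left _ _
  filter_upwards [h.eventually (lt_mem_nhds (show 2 - r ^ 2 < 2 by nlinarith))] with n hn
  linarith [hT.norm_add_gt hr hr1 (ha n) (hb n) hn]

/-- A sphere isometry transports asymptotically aligned finite families to asymptotically
aligned families, compatibly with antipodes. -/
theorem exists_aligned_map (hT : IsSphereIsometry T) {κ : Type*} [Fintype κ] [Nonempty κ]
    {A : κ → ℕ → E} (hA : ∀ j n, ‖A j n‖ = 1) {φ : ℕ → StrongDual ℝ E} (hφ : ∀ n, ‖φ n‖ ≤ 1)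
    (h : ∀ j, Tendsto (fun n => φ n (A j n)) atTop (𝓝 1)) :
    ∃ ψ : ℕ → StrongDual ℝ F, (∀ n, ‖ψ n‖ ≤ 1) ∧ ∀ j,
      Tendsto (fun n => ψ n (T (A j n))) atTop (𝓝 1) ∧
      Tendsto (fun n => ψ n (-T (-A j n))) atTop (𝓝 1) := by
  obtain ⟨S, hS, hST⟩ := hT.exists_inverse
  have hA' : ∀ j n, ‖-A j n‖ = 1 := fun j n => by rw [norm_neg, hA]
  obtain ⟨z, hz, hzA⟩ := exists_dominates_of_aligned hA hφ h
  have hstar : ∀ u : ℕ → F, (∀ n, ‖u n‖ = 1) → Dominates u (fun n => T (z n)) →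
      ∀ j : κ ⊕ κ, Tendsto (fun n => ‖u n + Sum.elim (fun i n => T (A i n))
        (fun i n => -T (-A i n)) j n‖) atTop (𝓝 2) := by
    intro u hu hup j
    have hTz : ∀ n, ‖T (z n)‖ = 1 := fun n => hT.norm_map _ (hz n)
    choose a ha hau using fun n => hT.surj (u n) (hu n)
    have haz : Tendsto (fun n => ‖a n + z n‖) atTop (𝓝 2) := by
      have := hS.tendsto_norm_add hu hTz (hup.tendsto_norm_add hu hTz)
      simpa only [← hau, hST _ (ha _), hST _ (hz _)] using this
    obtain ⟨χ, hχ, hχa, hχz⟩ := exists_dual_of_tendsto_norm_add ha hz haz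
    have haA : ∀ i, Tendsto (fun n => ‖a n + A i n‖) atTop (𝓝 2) := fun i =>
      _root_.tendsto_norm_add ha (hA i) hχ hχa (hzA i χ hχ hχz)
    rcases j with i | i
    · simpa only [Sum.elim_inl, ← hau] using hT.tendsto_norm_add ha (hA i) (haA i)
    · simpa only [Sum.elim_inr, ← hau, ← sub_eq_add_neg, hT.isometry _ _ (ha _) (hA' i _),
        sub_neg_eq_add] using haA i
  obtain ⟨u, hu, hd⟩ := exists_dominates_of_tendsto_norm_add
    (fun n => hT.norm_map _ (hz n)) (v := Sum.elim (fun i n => T (A i n))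
      (fun i n => -T (-A i n))) (by
        rintro (i | i) n
        · exact hT.norm_map _ (hA i n)
        · simpa using hT.norm_map _ (hA' i n)) hstar
  choose ψ hψ hψ' using fun n => exists_dual_vector'' ℝ (u n)
  have hψu : Tendsto (fun n => ψ n (u n)) atTop (𝓝 1) := by simp [hψ', hu]
  exact ⟨ψ, hψ, fun j => ⟨hd (Sum.inl j) ψ hψ hψu, hd (Sum.inr j) ψ hψ hψu⟩⟩

/-- A sphere isometry whose inverse respects vanishing of three-term linear combinations extends
to a linear isometric equivalence. -/
theorem exists_extension (hT : IsSphereIsometry T)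
    (h : ∀ (α : Fin 3 → ℝ) (y : Fin 3 → E), (∀ i, ‖y i‖ = 1) →
      ∑ i, α i • T (y i) = 0 → ∑ i, α i • y i = 0) :
    ∃ L : E ≃ₗᵢ[ℝ] F, ∀ x : E, ‖x‖ = 1 → L x = T x := by
  have hpolar : ∀ v : F, ∃ x : E, ‖x‖ = ‖v‖ ∧
      ((v = 0 ∧ x = 0) ∨ ∃ y : E, ‖y‖ = 1 ∧ x = ‖v‖ • y ∧ v = ‖v‖ • T y) := by
    intro v
    by_cases hv : v = 0
    · exact ⟨0, by simp [hv], Or.inl ⟨hv, rfl⟩⟩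
    · have hv' : ‖v‖ ≠ 0 := norm_ne_zero_iff.mpr hv
      obtain ⟨y, hy, hTy⟩ := hT.surj (‖v‖⁻¹ • v) (by simp [norm_smul, hv'])
      exact ⟨‖v‖ • y, by simp [norm_smul, hy], Or.inr ⟨y, hy, rfl, by simp [hTy, smul_smul, hv']⟩⟩
  choose P hPnorm hP using hpolar
  have hP' : ∀ y₀ : E, ‖y₀‖ = 1 → ∀ v, ∃ y : E, ‖y‖ = 1 ∧ P v = ‖v‖ • y ∧ v = ‖v‖ • T y := by
    intro y₀ hy₀ v
    rcases hP v with ⟨rfl, hv⟩ | hv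
    · exact ⟨y₀, hy₀, by simp [hv], by simp⟩
    · exact hv
  have hlin : ∀ (a b : ℝ) (u v w : F), a • u + b • v = w → a • P u + b • P v = P w := by
    intro a b u v w huvw
    by_cases hE : ∃ y₀ : E, ‖y₀‖ = 1
    · obtain ⟨y₀, hy₀⟩ := hE
      obtain ⟨x, hx, hPx, hux⟩ := hP' y₀ hy₀ u
      obtain ⟨y, hy, hPy, hvy⟩ := hP' y₀ hy₀ v
      obtain ⟨z, hz, hPz, hwz⟩ := hP' y₀ hy₀ w
      have := h ![a * ‖u‖, b * ‖v‖, -‖w‖] ![x, y, z] (by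
        intro i
        fin_cases i <;> assumption) (by
        simp only [Fin.sum_univ_three, Matrix.cons_val, mul_smul, neg_smul]
        rw [← hux, ← hvy, ← hwz, huvw, add_neg_cancel])
      simp only [Fin.sum_univ_three, Matrix.cons_val, mul_smul, neg_smul] at this
      rw [← hPx, ← hPy, ← hPz] at this
      exact add_neg_eq_zero.mp this
    · have h0 : ∀ x : E, x = 0 := fun x => by
        by_contra hx
        exact hE ⟨_, norm_inv_norm_smul hx⟩
      rw [h0 (P w), h0 (a • P u + b • P v)]
  let PL : F →ₗᵢ[ℝ] E :=
    { toFun := P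
      map_add' := fun u v => by simpa using (hlin 1 1 u v (u + v) (by simp)).symm
      map_smul' := fun c v => by simpa using (hlin c 0 v 0 (c • v) (by simp)).symm
      norm_map' := hPnorm }
  have hPLT : ∀ x : E, ‖x‖ = 1 → PL (T x) = x := by
    intro x hx
    obtain ⟨y, hy, hPy, hTy⟩ := hP' x hx (T x)
    rw [hT.norm_map x hx, one_smul] at hPy hTy
    have := hT.isometry x y hx hy
    rw [← hTy, sub_self, norm_zero] at this
    exact hPy.trans (sub_eq_zero.mp (norm_eq_zero.mp this.symm)).symm
  have hsurj : Function.Surjective PL := by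
    intro x
    by_cases hx : x = 0
    · exact ⟨0, by simp [hx]⟩
    · refine ⟨‖x‖ • T (‖x‖⁻¹ • x), ?_⟩
      rw [map_smul, hPLT _ (norm_inv_norm_smul hx), smul_smul, mul_inv_cancel₀ (norm_ne_zero_iff.mpr hx),
        one_smul]
  refine ⟨(LinearIsometryEquiv.ofSurjective PL hsurj).symm, fun x hx => ?_⟩
  rw [LinearIsometryEquiv.symm_apply_eq]
  exact (hPLT x hx).symm

end IsSphereIsometry

section CRich

variable {K : Type*} [TopologicalSpace K] [CompactSpace K] {E : Type*} [NormedAddCommGroup E]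
  [NormedSpace ℝ E] {J : E →ₗᵢ[ℝ] C(K, ℝ)}

/-- The range of the linear isometry `J` into `C(K)` is C-rich (not necessarily closed). -/
def IsCRichEmbedding (J : E →ₗᵢ[ℝ] C(K, ℝ)) : Prop :=
  ∀ U : Set K, IsOpen U → U.Nonempty → ∀ ε : ℝ, 0 < ε →
    ∃ h : C(K, ℝ), (∀ t, 0 ≤ h t) ∧ ‖h‖ = 1 ∧ tsupport ⇑h ⊆ U ∧ ∃ g : E, dist h (J g) < ε

/-- Adding bumps to finitely many norm-one functions in a C-rich subspace raises all of them to
almost `1` at a common point, at a cost governed by their values at `t₀`. -/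
theorem IsCRichEmbedding.exists_raised (hJ : IsCRichEmbedding J) {κ : Type*} [Fintype κ]
    {y : κ → E}
    (hy : ∀ j, ‖y j‖ = 1) (t₀ : K) {ε : ℝ} (hε : 0 < ε) :
    ∃ (s : K) (A : κ → E), ∀ j, ‖A j‖ = 1 ∧ 1 - ε ≤ J (A j) s ∧
      ‖A j - y j‖ ≤ 1 - J (y j) t₀ + ε := by
  set δ : ℝ := min (ε / 6) (1 / 6)
  have hδ : 0 < δ := lt_min (by linarith) (by norm_num)
  have hδε : δ ≤ ε / 6 := min_le_left _ _
  have hδ1 : δ ≤ 1 / 6 := min_le_right _ _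
  set U : Set K := ⋂ j, {t | |J (y j) t - J (y j) t₀| < δ}
  have hU : IsOpen U := isOpen_iInter_of_finite fun j =>
    isOpen_lt (by fun_prop) continuous_const
  have ht₀ : t₀ ∈ U := by simp [U, hδ]
  obtain ⟨h, h_nonneg, h_norm, h_supp, G, hg⟩ := hJ U hU ⟨t₀, ht₀⟩ δ hδ
  set g : C(K, ℝ) := J G with hgG
  have h_out : ∀ t, t ∉ U → h t = 0 := fun t ht => image_eq_zero_of_notMem_tsupport
    fun hmem => ht (h_supp hmem)
  have h_le : ∀ t, h t ≤ 1 := fun t =>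
    (Real.le_norm_self _).trans ((h.norm_coe_le_norm t).trans h_norm.le)
  have hgh : ∀ t, |h t - g t| ≤ δ := fun t => by
    have := (h - g).norm_coe_le_norm t
    rw [← dist_eq_norm] at this
    exact this.trans hg.le
  obtain ⟨s, hs⟩ : ∃ s, h s = 1 := by
    have : Nonempty K := ⟨t₀⟩
    obtain ⟨s, -, hs⟩ := isCompact_univ.exists_isMaxOn (f := h) univ_nonempty
      h.continuous.continuousOn
    refine ⟨s, le_antisymm (h_le s) ?_⟩
    rw [← h_norm]
    refine (ContinuousMap.norm_le _ (h_nonneg s)).mpr fun t => ?_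
    rw [Real.norm_of_nonneg (h_nonneg t)]
    exact hs (mem_univ t)
  have hsU : s ∈ U := by
    by_contra hsU
    linarith [h_out s hsU]
  refine ⟨s, ?_⟩
  suffices H : ∀ j, ∃ A : E, ‖A‖ = 1 ∧ 1 - ε ≤ J A s ∧
      ‖A - y j‖ ≤ 1 - J (y j) t₀ + ε by
    choose A hA using H
    exact ⟨A, hA⟩
  intro j
  have hyt : ∀ t, |J (y j) t| ≤ 1 := fun t =>
    ((J (y j)).norm_coe_le_norm t).trans ((J.norm_map _).trans (hy j)).le
  set c : ℝ := J (y j) t₀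
  have hyU : ∀ t ∈ U, |J (y j) t - c| < δ := fun t ht => mem_iInter.mp ht j
  have hc := abs_le.mp (hyt t₀)
  have hG : ‖G‖ ≤ 1 + δ := by
    have h₁ : ‖g‖ ≤ ‖h‖ + ‖h - g‖ := by simpa using norm_sub_le h (h - g)
    rw [← dist_eq_norm] at h₁
    rw [← J.norm_map]
    linarith
  set a : E := y j + (1 - c) • G with ha
  have hat : ∀ t, J a t = J (y j) t + (1 - c) * g t := fun t => by
    simp [ha, hgG]
  have ha_le : ‖a‖ ≤ 1 + 3 * δ := by
    rw [← J.norm_map]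
    refine (ContinuousMap.norm_le _ (by linarith)).mpr fun t => ?_
    rw [hat, Real.norm_eq_abs]
    have h₁ := abs_le.mp (hgh t)
    have h₂ := abs_le.mp (hyt t)
    have h₃ := h_nonneg t
    have h₄ := h_le t
    have h₅ : J (y j) t + (1 - c) * h t ≤ 1 + δ := by
      by_cases ht : t ∈ U
      · have := abs_lt.mp (hyU t ht)
        nlinarith
      · rw [h_out t ht]
        linarith
    rw [abs_le]
    constructor <;> nlinarith
  have has : 1 - 3 * δ ≤ J a s := by
    rw [hat]
    have h₁ := abs_le.mp (hgh s)
    have h₂ := abs_lt.mp (hyU s hsU)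
    rw [hs] at h₁
    nlinarith
  have ha_ge : 1 - 3 * δ ≤ ‖a‖ :=
    has.trans ((Real.le_norm_self _).trans
      (((J a).norm_coe_le_norm s).trans (J.norm_map a).le))
  have ha_pos : 0 < ‖a‖ := by linarith
  have ha_ne : a ≠ 0 := norm_pos_iff.mp ha_pos
  refine ⟨‖a‖⁻¹ • a, norm_inv_norm_smul ha_ne, ?_, ?_⟩
  · rw [map_smul, ContinuousMap.smul_apply, smul_eq_mul, inv_mul_eq_div, le_div_iff₀ ha_pos]
    by_cases hε1 : ε ≤ 1
    · nlinarith
    · nlinarith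
  · have h₁ : ‖‖a‖⁻¹ • a - a‖ ≤ 3 * δ := by
      rw [norm_inv_norm_smul_sub ha_ne, abs_le]
      constructor <;> linarith
    have h₂ : ‖a - y j‖ ≤ (1 - c) * (1 + δ) := by
      rw [ha, add_sub_cancel_left, norm_smul, Real.norm_of_nonneg (by linarith)]
      exact mul_le_mul_of_nonneg_left hG (by linarith)
    have h₃ := norm_sub_le_norm_sub_add_norm_sub (‖a‖⁻¹ • a) a (y j)
    nlinarith

/-- Point evaluation as a functional on a subspace of `C(K)` lies in the dual unit ball. -/
theorem exists_dual_eval (J : E →ₗᵢ[ℝ] C(K, ℝ)) (s : K) :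
    ∃ φ : StrongDual ℝ E, ‖φ‖ ≤ 1 ∧ ∀ x : E, φ x = J x s := by
  refine ⟨(ContinuousMap.evalCLM ℝ s).comp J.toContinuousLinearMap, ?_, fun _ => rfl⟩
  refine ContinuousLinearMap.opNorm_le_bound _ zero_le_one fun x => ?_
  rw [one_mul, ← J.norm_map x]
  exact (J x).norm_coe_le_norm s

/-- Evaluation at a point is asymptotically transported by a sphere isometry of a C-rich space
to functionals on the target, on finitely many unit vectors. -/
theorem IsCRichEmbedding.exists_dual_tendsto_eval (hJ : IsCRichEmbedding J) {F : Type*}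
    [NormedAddCommGroup F] [NormedSpace ℝ F] {T : E → F} (hT : IsSphereIsometry T) {ι : Type*}
    [Fintype ι] [Nonempty ι] {y : ι → E} (hy : ∀ i, ‖y i‖ = 1) (t₀ : K) :
    ∃ ψ : ℕ → StrongDual ℝ F,
      ∀ i, Tendsto (fun n => ψ n (T (y i))) atTop (𝓝 (J (y i) t₀)) := by
  have hY : ∀ j : ι ⊕ ι, ‖Sum.elim y (-y) j‖ = 1 := by
    rintro (i | i)
    · exact hy i
    · simpa using hy i
  obtain ⟨e, hpos, hlim⟩ : ∃ e : ℕ → ℝ, (∀ n, 0 < e n) ∧ Tendsto e atTop (𝓝 0) :=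
    ⟨fun n => 1 / ((n : ℝ) + 1), fun _ => Nat.one_div_pos_of_nat,
      tendsto_one_div_add_atTop_nhds_zero_nat⟩
  choose s A hA using fun n : ℕ => hJ.exists_raised hY t₀ (hpos n)
  choose φ hφ hφs using fun n => exists_dual_eval J (s n)
  obtain ⟨ψ, hψ, hψA⟩ := hT.exists_aligned_map (A := fun j n => A n j)
    (fun j n => (hA n j).1) hφ (fun j => by
      refine tendsto_of_tendsto_of_tendsto_of_le_of_le (by simpa using hlim.const_sub 1)
        tendsto_const_nhds (fun n => ?_) fun n => dual_apply_le_of_norm_le (hφ n) (hA n j).1.le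
      rw [hφs]
      exact (hA n j).2.1)
  refine ⟨ψ, fun i => ?_⟩
  set c : ℝ := J (y i) t₀ with hc
  have h₁ := ((hψA (Sum.inl i)).1.sub_const (1 - c)).sub hlim
  have h₂ := ((hψA (Sum.inr i)).2.neg.add_const (1 + c)).add hlim
  refine tendsto_of_tendsto_of_tendsto_of_le_of_le (by simpa using h₁) (by simpa using h₂)
    (fun n => ?_) fun n => ?_
  · have h := (hA n (Sum.inl i)).2.2
    have h' := dual_apply_le_of_norm_le (hψ n)
      ((hT.isometry _ _ (hA n (Sum.inl i)).1 (hy i)).trans_le h)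
    simp only [Sum.elim_inl, map_sub, ← hc] at h'
    simp only
    linarith
  · have h := (hA n (Sum.inr i)).2.2
    have hn : ‖-A n (Sum.inr i)‖ = 1 := by rw [norm_neg, (hA n (Sum.inr i)).1]
    have heq : ‖y i - -A n (Sum.inr i)‖ = ‖A n (Sum.inr i) - Sum.elim y (-y) (Sum.inr i)‖ := by
      congr 1
      simp [add_comm]
    have h' := dual_apply_le_of_norm_le (hψ n) ((hT.isometry _ _ (hy i) hn).trans_le (heq.trans_le h))
    simp only [Sum.elim_inr, map_sub, Pi.neg_apply, map_neg, ContinuousMap.neg_apply,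
      ← hc] at h'
    simp only
    linarith

/-- The Mazur–Ulam property for spaces embedded in `C(K)` as C-rich subspaces. -/
theorem IsCRichEmbedding.exists_extension (hJ : IsCRichEmbedding J) {F : Type*}
    [NormedAddCommGroup F] [NormedSpace ℝ F] {T : E → F} (hT : IsSphereIsometry T) :
    ∃ L : E ≃ₗᵢ[ℝ] F, ∀ x : E, ‖x‖ = 1 → L x = T x := by
  refine hT.exists_extension fun α y hy h0 => J.injective (ContinuousMap.ext fun t₀ => ?_)
  obtain ⟨ψ, hψ⟩ := hJ.exists_dual_tendsto_eval hT hy t₀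
  have h : Tendsto (fun n => ∑ i, α i * ψ n (T (y i))) atTop (𝓝 (∑ i, α i * J (y i) t₀)) :=
    tendsto_finsetSum _ fun i _ => (hψ i).const_mul (α i)
  have hzero : ∀ n, ∑ i, α i * ψ n (T (y i)) = 0 := fun n => by
    simpa using congrArg (ψ n) h0
  simp only [hzero] at h
  simpa [ContinuousMap.sum_apply] using (tendsto_nhds_unique h tendsto_const_nhds)

end CRich

theorem IsCRich.exists_isCRichEmbedding {K : Type*} [TopologicalSpace K] [CompactSpace K]
    {X : Subspace ℝ C(K, ℝ)} (hX : IsCRich X) :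
    ∃ J : X →ₗᵢ[ℝ] C(K, ℝ), IsCRichEmbedding J := by
  let J : X →ₗᵢ[ℝ] C(K, ℝ) :=
    { toFun := Subtype.val
      map_add' := fun _ _ => rfl
      map_smul' := fun _ _ => rfl
      norm_map' := fun _ => rfl }
  refine ⟨J, fun U hU hne ε hε => ?_⟩
  obtain ⟨h, h_nonneg, h_norm, h_supp, h_dist⟩ := hX.2 U hU hne ε hε
  obtain ⟨g, hgX, hg⟩ := (infDist_lt_iff ⟨0, X.zero_mem⟩).mp h_dist
  exact ⟨h, h_nonneg, h_norm, h_supp, ⟨g, hgX⟩, hg⟩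

open ContinuousMap in
/-- Corollary 3.9: every C-rich (closed) subspace `X` of `C(K)` has the Mazur–Ulam
property: for every Banach space `F`, every surjective isometry `T : S_X → S_F` extends
to a surjective linear isometry `X ≃ F`. -/
theorem stmt_17 {K : Type*} [TopologicalSpace K] [CompactSpace K] [T2Space K]
    (X : Subspace ℝ C(K, ℝ)) (hX : IsCRich X)
    {F : Type*} [NormedAddCommGroup F] [NormedSpace ℝ F] [CompleteSpace F]
    (T : X → F)
    (hmap : ∀ x : X, ‖x‖ = 1 → ‖T x‖ = 1)
    (hsurj : ∀ z : F, ‖z‖ = 1 → ∃ x : X, ‖x‖ = 1 ∧ T x = z)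
    (hiso : ∀ x y : X, ‖x‖ = 1 → ‖y‖ = 1 → ‖T x - T y‖ = ‖x - y‖) :
    ∃ L : X ≃ₗᵢ[ℝ] F, ∀ x : X, ‖x‖ = 1 → L x = T x := by
  obtain ⟨J, hJ⟩ := IsCRich.exists_isCRichEmbedding hX
  exact hJ.exists_extension ⟨hmap, hsurj, hiso⟩
end

section
/- Let K be a compact Hausdorff space and let E be a real local-GL-space. Then C(K, E) is a local-GL-space: for every separable closed subspace X of C(K, E) there exists a closed subspace Y of C(K, E) with X ⊆ Y such that Y, with the induced norm, is a GL-space. -/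
open Metric Set

/-- A Banach space `E` is a local-GL-space if every separable closed subspace of `E` is
contained in a closed subspace of `E` which, with the induced norm, is a GL-space. -/
def IsLocalGLSpace (E : Type*) [NormedAddCommGroup E] [NormedSpace ℝ E] : Prop :=
  ∀ X : Subspace ℝ E, IsClosed (X : Set E) → TopologicalSpace.SeparableSpace X →
    ∃ Y : Subspace ℝ E, IsClosed (Y : Set E) ∧ X ≤ Y ∧ IsGLSpace Y

theorem convex_glSlice {E : Type*} [NormedAddCommGroup E] [NormedSpace ℝ E]
    (f : E →L[ℝ] ℝ) (ε : ℝ) : Convex ℝ (glSlice f ε) := by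
  have h : glSlice f ε = closedBall 0 1 ∩ {x | 1 - ε < f x} := by
    ext x; simp [glSlice]
  rw [h]
  exact (convex_closedBall 0 1).inter (convex_halfSpace_gt f.toLinearMap.isLinear (1 - ε))

/-- The inequality defining a GL-space, stated on the sphere through infimum distances, yields
approximants in the slice and its opposite for every point of the closed unit ball. -/
theorem exists_mem_glSlice_of_norm_le_one {E : Type*} [NormedAddCommGroup E] [NormedSpace ℝ E]
    {f : E →L[ℝ] ℝ} {ε : ℝ} {x : E} (hx : ‖x‖ = 1) (hxS : x ∈ glSlice f ε)
    (h : ∀ y : E, ‖y‖ = 1 →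
      infDist y (glSlice f ε) + infDist y (-(glSlice f ε)) < 2 + ε)
    (y : E) (hy : ‖y‖ ≤ 1) :
    ∃ u ∈ glSlice f ε, ∃ v ∈ -(glSlice f ε), ‖y - u‖ + ‖y - v‖ < 2 + ε := by
  obtain ⟨e, he, hye⟩ : ∃ e : E, ‖e‖ = 1 ∧ y = ‖y‖ • e := by
    rcases eq_or_ne y 0 with rfl | hy0
    · exact ⟨x, hx, by simp⟩
    · have hn : ‖y‖ ≠ 0 := norm_ne_zero_iff.2 hy0
      exact ⟨‖y‖⁻¹ • y, by simp [norm_smul, hn], by simp [smul_smul, hn]⟩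
  obtain ⟨η, hη, hlt⟩ : ∃ η > 0,
      infDist e (glSlice f ε) + infDist e (-(glSlice f ε)) + 2 * η ≤ 2 + ε :=
    ⟨(2 + ε - (infDist e (glSlice f ε) + infDist e (-(glSlice f ε)))) / 2,
      by linarith [h e he], by linarith⟩
  obtain ⟨u, hu, hu'⟩ := (infDist_lt_iff ⟨x, hxS⟩).1
    (lt_add_of_pos_right (infDist e (glSlice f ε)) hη)
  obtain ⟨v, hv, hv'⟩ := (infDist_lt_iff (s := -(glSlice f ε)) ⟨-x, by simpa using hxS⟩).1
    (lt_add_of_pos_right (infDist e (-(glSlice f ε))) hη)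
  rw [dist_eq_norm] at hu' hv'
  set a := (1 + ‖y‖) / 2 with ha
  set b := (1 - ‖y‖) / 2 with hb
  have ha0 : 0 ≤ a := by positivity
  have hb0 : 0 ≤ b := by rw [hb]; linarith
  have hab : a + b = 1 := by rw [ha, hb]; ring
  have hyab : y = (a - b) • e := by
    rw [show a - b = ‖y‖ by rw [ha, hb]; ring]; exact hye
  have key : ∀ p q : E, ‖a • p - b • q‖ ≤ a * ‖p‖ + b * ‖q‖ := fun p q => by
    refine (norm_sub_le _ _).trans_eq ?_
    rw [norm_smul_of_nonneg ha0, norm_smul_of_nonneg hb0]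
  have h₁ := key (e - u) (e - v)
  have h₂ := key (e - v) (e - u)
  rw [show a • (e - u) - b • (e - v) = y - (a • u + b • -v) by rw [hyab]; module] at h₁
  rw [show a • (e - v) - b • (e - u) = y - (a • v + b • -u) by rw [hyab]; module] at h₂
  refine ⟨_, convex_glSlice f ε hu hv ha0 hb0 hab, a • v + b • -u, ?_, ?_⟩
  · rw [Set.mem_neg, show -(a • v + b • -u) = a • -v + b • u by module]
    exact convex_glSlice f ε hv hu ha0 hb0 hab
  · have : a * ‖e - u‖ + b * ‖e - v‖ + (a * ‖e - v‖ + b * ‖e - u‖)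
        = (a + b) * (‖e - u‖ + ‖e - v‖) := by ring
    rw [hab] at this
    linarith

/-- The subspace of `C(K, E)` of functions with values in the subspace `Y` of `E`. -/
def continuousMapInto (K : Type*) [TopologicalSpace K] {E : Type*} [NormedAddCommGroup E]
    [NormedSpace ℝ E] (Y : Subspace ℝ E) : Subspace ℝ C(K, E) where
  carrier := {f | ∀ t, f t ∈ Y}
  add_mem' hf hg t := Y.add_mem (hf t) (hg t)
  zero_mem' _ := Y.zero_mem
  smul_mem' c _ hf t := Y.smul_mem c (hf t)

section

variable {K : Type*} [TopologicalSpace K] {E : Type*} [NormedAddCommGroup E] [NormedSpace ℝ E]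

theorem isClosed_continuousMapInto {Y : Subspace ℝ E} (hY : IsClosed (Y : Set E)) :
    IsClosed (continuousMapInto K Y : Set C(K, E)) := by
  change IsClosed {f : C(K, E) | ∀ t, f t ∈ Y}
  rw [Set.ofPred_forall]
  exact isClosed_iInter fun t => hY.preimage (continuous_eval_const t)

/-- Given a function `g` in the unit ball and a point `u` of the unit ball, `g` can be modified
near `t` within the unit ball so as to take the value `u` at `t`, moving it by little more than
`‖g t - u‖`. -/
theorem exists_continuousMapInto_eq [CompactSpace K] [T2Space K] {Y : Subspace ℝ E}
    {g : C(K, E)} (hgY : g ∈ continuousMapInto K Y) (hg : ‖g‖ ≤ 1) (t : K) {u : E} (huY : u ∈ Y)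
    (hu : ‖u‖ ≤ 1) {δ : ℝ} (hδ : 0 < δ) :
    ∃ h ∈ continuousMapInto K Y, ‖h‖ ≤ 1 ∧ h t = u ∧ ‖g - h‖ ≤ ‖g t - u‖ + δ := by
  have hopen : IsOpen {s | ‖g s - g t‖ < δ} :=
    isOpen_lt (by fun_prop) continuous_const
  obtain ⟨φ, hφ₀, hφ₁, hφ⟩ := exists_continuous_zero_one_of_isClosed hopen.isClosed_compl
    (isClosed_singleton (x := t)) (by simpa using hδ)
  have hφt : φ t = 1 := hφ₁ rfl
  refine ⟨⟨fun s => (1 - φ s) • g s + φ s • u, by fun_prop⟩, fun s => ?_, ?_, ?_, ?_⟩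
  · exact Y.add_mem (Y.smul_mem _ (hgY s)) (Y.smul_mem _ huY)
  · refine (ContinuousMap.norm_le _ zero_le_one).2 fun s => ?_
    have := (convex_closedBall (0 : E) 1) (x := g s)
      (by simpa using (g.norm_coe_le_norm s).trans hg) (y := u) (by simpa using hu)
      (sub_nonneg.2 (hφ s).2) (hφ s).1 (by ring)
    simpa using this
  · simp [hφt]
  · refine (ContinuousMap.norm_le _ (by positivity)).2 fun s => ?_
    have hs : (g - ⟨fun s => (1 - φ s) • g s + φ s • u, by fun_prop⟩ : C(K, E)) s
        = φ s • (g s - u) := by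
      simp only [ContinuousMap.sub_apply, ContinuousMap.coe_mk]
      module
    rw [hs, norm_smul_of_nonneg (hφ s).1]
    by_cases hmem : ‖g s - g t‖ < δ
    · calc φ s * ‖g s - u‖ ≤ ‖g s - u‖ := mul_le_of_le_one_left (norm_nonneg _) (hφ s).2
        _ ≤ ‖g s - g t‖ + ‖g t - u‖ := norm_sub_le_norm_sub_add_norm_sub _ _ _
        _ ≤ ‖g t - u‖ + δ := by linarith
    · have : φ s = 0 := hφ₀ hmem
      rw [this, zero_mul]
      positivity

theorem IsGLSpace.continuousMap [CompactSpace K] [T2Space K] {Y : Subspace ℝ E}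
    (hY : IsGLSpace Y) : IsGLSpace (continuousMapInto K Y) := by
  intro f hf ε hε
  have hf' : ‖(f : C(K, E))‖ = 1 := hf
  have : Nonempty K := by
    by_contra hK
    rw [not_nonempty_iff] at hK
    have h0 : (f : C(K, E)) = 0 := ContinuousMap.ext fun t => hK.elim t
    simp [h0] at hf'
  obtain ⟨t, ht⟩ : ∃ t, ‖(f : C(K, E)) t‖ = 1 := by
    obtain ⟨t, -, ht⟩ := isCompact_univ.exists_isMaxOn univ_nonempty
      (f : C(K, E)).continuous.norm.continuousOn
    refine ⟨t, le_antisymm (hf' ▸ (f : C(K, E)).norm_coe_le_norm t) ?_⟩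
    rw [← hf']
    exact (ContinuousMap.norm_le _ (norm_nonneg _)).2 fun s => ht (mem_univ s)
  have hft : ‖(⟨(f : C(K, E)) t, f.2 t⟩ : Y)‖ = 1 := ht
  obtain ⟨φ, hφ, hfφ, hdist⟩ := hY ⟨(f : C(K, E)) t, f.2 t⟩ hft (ε / 2) (half_pos hε)
  let ev : continuousMapInto K Y →L[ℝ] Y :=
    ((ContinuousMap.evalCLM ℝ t).comp (Submodule.subtypeL _)).codRestrict Y fun g => g.2 t
  have hev : ∀ g : continuousMapInto K Y, ev g = ⟨(g : C(K, E)) t, g.2 t⟩ := fun _ => rfl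
  have hev_le : ∀ g, ‖ev g‖ ≤ ‖g‖ := fun g => (g : C(K, E)).norm_coe_le_norm t
  have hle : ‖φ.comp ev‖ ≤ 1 := ContinuousLinearMap.opNorm_le_bound _ zero_le_one fun g =>
    (φ.le_opNorm _).trans (by rw [hφ]; simpa using hev_le g)
  have hge : 1 ≤ ‖φ.comp ev‖ := by
    rw [← hφ]
    refine φ.opNorm_le_bound (norm_nonneg (φ.comp ev)) fun y => ?_
    let c : continuousMapInto K Y := ⟨ContinuousMap.const K (y : E), fun _ => y.2⟩
    have hc : ‖c‖ ≤ ‖y‖ := (ContinuousMap.norm_le _ (norm_nonneg _)).2 fun _ => le_rfl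
    exact ((φ.comp ev).le_opNorm c).trans (mul_le_mul_of_nonneg_left hc (norm_nonneg _))
  have hmem : ∀ g : continuousMapInto K Y, ‖g‖ ≤ 1 → ev g ∈ glSlice φ (ε / 2) →
      g ∈ glSlice (φ.comp ev) ε := fun g hg h =>
    ⟨hg, lt_trans (by linarith) h.2⟩
  refine ⟨φ.comp ev, le_antisymm hle hge, hmem f hf.le hfφ, fun g hg => ?_⟩
  obtain ⟨u, hu, v, hv, huv⟩ := exists_mem_glSlice_of_norm_le_one hft hfφ hdist (ev g)
    ((hev_le g).trans hg.le)
  have hv1 : ‖(v : E)‖ ≤ 1 := by simpa using hv.1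
  have hδ : 0 < ε / 4 := by positivity
  obtain ⟨p, hpY, hp, hpt, hgp⟩ := exists_continuousMapInto_eq g.2 hg.le t u.2 hu.1 hδ
  obtain ⟨q, hqY, hq, hqt, hgq⟩ := exists_continuousMapInto_eq g.2 hg.le t v.2 hv1 hδ
  have hpS : (⟨p, hpY⟩ : continuousMapInto K Y) ∈ glSlice (φ.comp ev) ε :=
    hmem _ hp (by rw [hev]; convert hu)
  have hqS : (⟨q, hqY⟩ : continuousMapInto K Y) ∈ -glSlice (φ.comp ev) ε := by
    refine hmem _ (by rw [norm_neg]; exact hq) ?_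
    rw [map_neg, hev]
    have : (⟨q t, hqY t⟩ : Y) = v := Subtype.ext hqt
    rw [this]
    exact hv
  have h₁ := infDist_le_dist_of_mem (x := g) hpS
  have h₂ := infDist_le_dist_of_mem (x := g) hqS
  have h₃ : dist g ⟨p, hpY⟩ ≤ ‖ev g - u‖ + ε / 4 := by rw [dist_eq_norm]; exact hgp
  have h₄ : dist g ⟨q, hqY⟩ ≤ ‖ev g - v‖ + ε / 4 := by rw [dist_eq_norm]; exact hgq
  linarith

end

/-- The values of the functions in a separable set of continuous functions on a compact space
form a separable set. -/
theorem TopologicalSpace.IsSeparable.iUnion_range_continuousMap {K : Type*}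
    [TopologicalSpace K] [CompactSpace K] {E : Type*} [NormedAddCommGroup E]
    {X : Set C(K, E)} (hX : TopologicalSpace.IsSeparable X) :
    TopologicalSpace.IsSeparable (⋃ f ∈ X, range f) := by
  obtain ⟨c, hc, hXc⟩ := hX
  have hsep : TopologicalSpace.IsSeparable (⋃ f ∈ c, range f) := by
    have := hc.to_subtype
    rw [biUnion_eq_iUnion]
    exact .iUnion fun f => (isCompact_range f.1.continuous).isSeparable
  refine hsep.closure.mono (iUnion₂_subset fun f hf => ?_)
  rintro _ ⟨t, rfl⟩
  exact map_mem_closure (f := fun g : C(K, E) => g t) (continuous_eval_const t) (hXc hf)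
    fun g hg => mem_iUnion₂.2 ⟨g, hg, t, rfl⟩

open ContinuousMap in
/-- Proposition 3.10: if `E` is a local-GL-space and `K` is a compact Hausdorff space,
then `C(K, E)` is a local-GL-space. -/
theorem stmt_19 {K : Type*} [TopologicalSpace K] [CompactSpace K] [T2Space K]
    {E : Type*} [NormedAddCommGroup E] [NormedSpace ℝ E] [CompleteSpace E]
    (hE : IsLocalGLSpace E) :
    IsLocalGLSpace C(K, E) := by
  intro X _ hXsep
  have hX := TopologicalSpace.IsSeparable.of_subtype (X : Set C(K, E))
  have hsep := hX.iUnion_range_continuousMap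
  have hspan := (hsep.span (R := ℝ)).closure
  rw [← Submodule.topologicalClosure_coe] at hspan
  obtain ⟨Y, hYc, hle, hY⟩ := hE _ (Submodule.isClosed_topologicalClosure _) hspan.separableSpace
  refine ⟨continuousMapInto K Y, isClosed_continuousMapInto hYc, fun f hf t => ?_,
    hY.continuousMap⟩
  exact hle (Submodule.le_topologicalClosure _ (Submodule.subset_span
    (mem_biUnion hf (mem_range_self t))))
end
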